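/- (One-step contraction of the Gauss-Newton method.) Suppose K ∈ 𝕂 and let K'_i = K_i − 2η(R_i + B_iᵀ E_i(P^K) B_i)^{−1} L^K_i for i = 1,…,N with 0 < η ≤ 1/2. Then C(K') − C(K*) ≤ (1 − 2μη/‖𝐗^{K*}‖_max)·(C(K) − C(K*)). -/

import Mathlib

open Matrix Filter
open scoped Kronecker Topology

namespace MJLS

noncomputable section

attribute [local instance] Classical.propDecidable

/-- Closed-loop matrices `Γ i = A i - B i * K i`. -/
def Gam {d k N : ℕ} (A : Fin N → Matrix (Fin d) (Fin d) ℝ)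
    (B : Fin N → Matrix (Fin d) (Fin k) ℝ)
    (K : Fin N → Matrix (Fin k) (Fin d) ℝ) : Fin N → Matrix (Fin d) (Fin d) ℝ :=
  fun i => A i - B i * K i

/-- The operator `E_i(V) = ∑ j, p i j • V j`. -/
def opE {d N : ℕ} (Pr : Matrix (Fin N) (Fin N) ℝ)
    (V : Fin N → Matrix (Fin d) (Fin d) ℝ) : Fin N → Matrix (Fin d) (Fin d) ℝ :=
  fun i => ∑ j, Pr i j • V j

/-- The matrix `𝒜 = diag(Γᵀ ⊗ Γᵀ) (P ⊗ I)`. -/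
def calA {d N : ℕ} (Pr : Matrix (Fin N) (Fin N) ℝ)
    (Γ : Fin N → Matrix (Fin d) (Fin d) ℝ) :
    Matrix (Fin N × Fin d × Fin d) (Fin N × Fin d × Fin d) ℝ :=
  (Matrix.reindex (Equiv.prodComm (Fin d × Fin d) (Fin N))
      (Equiv.prodComm (Fin d × Fin d) (Fin N))
      (Matrix.blockDiagonal fun i => (Γ i)ᵀ ⊗ₖ (Γ i)ᵀ)) *
    (Pr ⊗ₖ (1 : Matrix (Fin d × Fin d) (Fin d × Fin d) ℝ))

/-- `K` is mean-square stabilizing: the spectral radius of `𝒜` is less than `1`. -/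
def MSS {d k N : ℕ} (Pr : Matrix (Fin N) (Fin N) ℝ)
    (A : Fin N → Matrix (Fin d) (Fin d) ℝ) (B : Fin N → Matrix (Fin d) (Fin k) ℝ)
    (K : Fin N → Matrix (Fin k) (Fin d) ℝ) : Prop :=
  spectralRadius ℂ ((calA Pr (Gam A B K)).map (algebraMap ℝ ℂ)) < 1

/-- `P` solves the coupled Lyapunov equations for the policy `K`. -/
def IsLyap {d k N : ℕ} (Pr : Matrix (Fin N) (Fin N) ℝ)
    (A : Fin N → Matrix (Fin d) (Fin d) ℝ) (B : Fin N → Matrix (Fin d) (Fin k) ℝ)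
    (Q : Fin N → Matrix (Fin d) (Fin d) ℝ) (R : Fin N → Matrix (Fin k) (Fin k) ℝ)
    (K : Fin N → Matrix (Fin k) (Fin d) ℝ)
    (P : Fin N → Matrix (Fin d) (Fin d) ℝ) : Prop :=
  ∀ i, P i = Q i + (K i)ᵀ * R i * K i + (Gam A B K i)ᵀ * opE Pr P i * Gam A B K i

/-- `P^K`, the (for mean-square stabilizing `K`, unique) solution of the coupled
Lyapunov equations. -/
def PK {d k N : ℕ} (Pr : Matrix (Fin N) (Fin N) ℝ)
    (A : Fin N → Matrix (Fin d) (Fin d) ℝ) (B : Fin N → Matrix (Fin d) (Fin k) ℝ)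
    (Q : Fin N → Matrix (Fin d) (Fin d) ℝ) (R : Fin N → Matrix (Fin k) (Fin k) ℝ)
    (K : Fin N → Matrix (Fin k) (Fin d) ℝ) : Fin N → Matrix (Fin d) (Fin d) ℝ :=
  if h : ∃ P, IsLyap Pr A B Q R K P then h.choose else 0

/-- The LQR cost `C(K) = ∑ i, π i * tr(P^K_i Sg)`. -/
def cost {d k N : ℕ} (Pr : Matrix (Fin N) (Fin N) ℝ)
    (A : Fin N → Matrix (Fin d) (Fin d) ℝ) (B : Fin N → Matrix (Fin d) (Fin k) ℝ)
    (Q : Fin N → Matrix (Fin d) (Fin d) ℝ) (R : Fin N → Matrix (Fin k) (Fin k) ℝ)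
    (piv : Fin N → ℝ) (Sg : Matrix (Fin d) (Fin d) ℝ)
    (K : Fin N → Matrix (Fin k) (Fin d) ℝ) : ℝ :=
  ∑ i, piv i * (PK Pr A B Q R K i * Sg).trace

/-- The operator `T_j(V) = ∑ i, p i j • (Γ i * V i * Γ iᵀ)`. -/
def opT {d N : ℕ} (Pr : Matrix (Fin N) (Fin N) ℝ)
    (Γ : Fin N → Matrix (Fin d) (Fin d) ℝ)
    (V : Fin N → Matrix (Fin d) (Fin d) ℝ) : Fin N → Matrix (Fin d) (Fin d) ℝ :=
  fun j => ∑ i, Pr i j • (Γ i * V i * (Γ i)ᵀ)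

/-- `𝐗^K = ∑_{t=0}^∞ T^t(X(0))` with `X_i(0) = π i • Sg`. -/
def XK {d N : ℕ} (Pr : Matrix (Fin N) (Fin N) ℝ) (piv : Fin N → ℝ)
    (Sg : Matrix (Fin d) (Fin d) ℝ) (Γ : Fin N → Matrix (Fin d) (Fin d) ℝ) :
    Fin N → Matrix (Fin d) (Fin d) ℝ :=
  ∑' t : ℕ, (opT Pr Γ)^[t] (fun i => piv i • Sg)

/-- `L^K_i = (R i + B iᵀ E_i(P^K) B i) K i - B iᵀ E_i(P^K) A i`. -/
def LK {d k N : ℕ} (Pr : Matrix (Fin N) (Fin N) ℝ)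
    (A : Fin N → Matrix (Fin d) (Fin d) ℝ) (B : Fin N → Matrix (Fin d) (Fin k) ℝ)
    (Q : Fin N → Matrix (Fin d) (Fin d) ℝ) (R : Fin N → Matrix (Fin k) (Fin k) ℝ)
    (K : Fin N → Matrix (Fin k) (Fin d) ℝ) : Fin N → Matrix (Fin k) (Fin d) ℝ :=
  fun i => (R i + (B i)ᵀ * opE Pr (PK Pr A B Q R K) i * B i) * K i
    - (B i)ᵀ * opE Pr (PK Pr A B Q R K) i * A i

/-- The operator `L_i(V) = Γ iᵀ E_i(V) Γ i`. -/
def opL {d N : ℕ} (Pr : Matrix (Fin N) (Fin N) ℝ)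
    (Γ : Fin N → Matrix (Fin d) (Fin d) ℝ)
    (V : Fin N → Matrix (Fin d) (Fin d) ℝ) : Fin N → Matrix (Fin d) (Fin d) ℝ :=
  fun i => (Γ i)ᵀ * opE Pr V i * Γ i

/-- `(P^K)'[E] = ∑_{t=0}^∞ L^t(Eᵀ L^K + (L^K)ᵀ E)`. -/
def PKd {d k N : ℕ} (Pr : Matrix (Fin N) (Fin N) ℝ)
    (Γ : Fin N → Matrix (Fin d) (Fin d) ℝ)
    (Lk E : Fin N → Matrix (Fin k) (Fin d) ℝ) : Fin N → Matrix (Fin d) (Fin d) ℝ :=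
  ∑' t : ℕ, (opL Pr Γ)^[t] (fun i => (E i)ᵀ * Lk i + (Lk i)ᵀ * E i)

/-- `‖V‖₂² = ∑ i, tr(V iᵀ V i)`. -/
def norm2sq {a b N : ℕ} (V : Fin N → Matrix (Fin a) (Fin b) ℝ) : ℝ :=
  ∑ i, ((V i)ᵀ * V i).trace

/-- The inner product `⟨V, S⟩ = ∑ i, tr(V iᵀ S i)`. -/
def ip {a b N : ℕ} (V S : Fin N → Matrix (Fin a) (Fin b) ℝ) : ℝ :=
  ∑ i, ((V i)ᵀ * S i).trace

/-- The spectral norm (maximal singular value) of a matrix. -/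
def specNorm {a b : ℕ} (M : Matrix (Fin a) (Fin b) ℝ) : ℝ :=
  ⨆ x : {x : EuclideanSpace ℝ (Fin b) // ‖x‖ ≤ 1}, ‖Matrix.toEuclideanLin M x.1‖

/-- The minimal singular value of a square matrix. -/
def sigmaMin {a : ℕ} (M : Matrix (Fin a) (Fin a) ℝ) : ℝ :=
  ⨅ x : {x : EuclideanSpace ℝ (Fin a) // ‖x‖ = 1}, ‖Matrix.toEuclideanLin M x.1‖

/-- `‖V‖_max = max_i ‖V i‖` (spectral norms). -/
def maxNorm {a b N : ℕ} (V : Fin N → Matrix (Fin a) (Fin b) ℝ) : ℝ :=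
  ⨆ i, specNorm (V i)

/-- `Λ_min(V) = min_i σ_min(V i)`. -/
def lamMin {a N : ℕ} (V : Fin N → Matrix (Fin a) (Fin a) ℝ) : ℝ :=
  ⨅ i, sigmaMin (V i)

/-- `μ = (min_i π i) · σ_min(Sg)`. -/
def mu {d N : ℕ} (piv : Fin N → ℝ) (Sg : Matrix (Fin d) (Fin d) ℝ) : ℝ :=
  (⨅ i, piv i) * sigmaMin Sg

/-- `ξ(α) = (1/Λ_min(Q))·((1 + ‖B‖²_max)·α/μ + ‖R‖_max) − 1`. -/
def xi {d k N : ℕ} (B : Fin N → Matrix (Fin d) (Fin k) ℝ)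
    (R : Fin N → Matrix (Fin k) (Fin k) ℝ) (Q : Fin N → Matrix (Fin d) (Fin d) ℝ)
    (piv : Fin N → ℝ) (Sg : Matrix (Fin d) (Fin d) ℝ) (α : ℝ) : ℝ :=
  (1 / lamMin Q) * ((1 + maxNorm B ^ 2) * α / mu piv Sg + maxNorm R) - 1

/-- The smoothness constant
`L(α) = 2·(‖R‖_max + ‖B‖²_max·(1 + 2ξ(α)/‖B‖_max)·α/μ)·α/Λ_min(Q)`. -/
def Lsm {d k N : ℕ} (B : Fin N → Matrix (Fin d) (Fin k) ℝ)
    (R : Fin N → Matrix (Fin k) (Fin k) ℝ) (Q : Fin N → Matrix (Fin d) (Fin d) ℝ)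
    (piv : Fin N → ℝ) (Sg : Matrix (Fin d) (Fin d) ℝ) (α : ℝ) : ℝ :=
  2 * (maxNorm R + maxNorm B ^ 2 * (1 + 2 * xi B R Q piv Sg α / maxNorm B)
      * α / mu piv Sg) * α / lamMin Q

end

lemma fix_tsum {E : Type*} [AddCommGroup E] [Module ℝ E] [TopologicalSpace E]
    [IsTopologicalAddGroup E] [T2Space E] (F : E →ₗ[ℝ] E) (hc : Continuous F) (v : E)
    (hs : Summable fun t : ℕ => F^[t] v) :
    ∑' t : ℕ, F^[t] v = v + F (∑' t : ℕ, F^[t] v) := by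
  have h1 := hs.tsum_eq_zero_add
  have h2 : HasSum (fun t : ℕ => F (F^[t] v)) (F (∑' t : ℕ, F^[t] v)) :=
    hs.hasSum.map F hc
  rw [← h2.tsum_eq]
  simpa [Function.iterate_succ_apply'] using h1

lemma eq_zero_of_fix {E : Type*} [AddCommGroup E] [TopologicalSpace E]
    [IsTopologicalAddGroup E] [T2Space E] (F : E → E) (v : E) (hv : F v = v)
    (hs : Summable fun t : ℕ => F^[t] v) : v = 0 := by
  have h : (fun t : ℕ => F^[t] v) = fun _ => v := by
    funext t
    exact Function.iterate_fixed hv t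
  rw [h] at hs
  have := hs.tendsto_atTop_zero
  exact tendsto_nhds_unique tendsto_const_nhds this

/-- `opL` as a linear map. -/
def linL {d N : ℕ} (Pr : Matrix (Fin N) (Fin N) ℝ) (Γ : Fin N → Matrix (Fin d) (Fin d) ℝ) :
    (Fin N → Matrix (Fin d) (Fin d) ℝ) →ₗ[ℝ] (Fin N → Matrix (Fin d) (Fin d) ℝ) where
  toFun := opL Pr Γ
  map_add' V W := by
    funext i
    simp [opL, opE, Finset.sum_add_distrib, Matrix.mul_add, Matrix.add_mul]
  map_smul' c V := by
    funext i
    simp only [opL, opE, Pi.smul_apply, RingHom.id_apply]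
    rw [← Matrix.smul_mul, ← Matrix.mul_smul, Finset.smul_sum]
    simp only [smul_comm c]

/-- `opT` as a linear map. -/
def linT {d N : ℕ} (Pr : Matrix (Fin N) (Fin N) ℝ) (Γ : Fin N → Matrix (Fin d) (Fin d) ℝ) :
    (Fin N → Matrix (Fin d) (Fin d) ℝ) →ₗ[ℝ] (Fin N → Matrix (Fin d) (Fin d) ℝ) where
  toFun := opT Pr Γ
  map_add' V W := by
    funext i
    simp [opT, Finset.sum_add_distrib, Matrix.mul_add, Matrix.add_mul]
  map_smul' c V := by
    funext i
    simp only [opT, Pi.smul_apply, RingHom.id_apply]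
    rw [Finset.smul_sum]
    simp only [Matrix.smul_mul, Matrix.mul_smul, smul_comm c]

lemma cont_opL {d N : ℕ} (Pr : Matrix (Fin N) (Fin N) ℝ) (Γ : Fin N → Matrix (Fin d) (Fin d) ℝ) :
    Continuous (opL Pr Γ) := by
  unfold opL opE
  fun_prop

lemma cont_opT {d N : ℕ} (Pr : Matrix (Fin N) (Fin N) ℝ) (Γ : Fin N → Matrix (Fin d) (Fin d) ℝ) :
    Continuous (opT Pr Γ) := by
  unfold opT
  fun_prop

/-- Stability: all orbits of `opL` are summable. -/
def Stab {d N : ℕ} (Pr : Matrix (Fin N) (Fin N) ℝ) (Γ : Fin N → Matrix (Fin d) (Fin d) ℝ) : Prop :=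
  ∀ V, Summable fun t : ℕ => (opL Pr Γ)^[t] V

lemma opE_psd {d N : ℕ} {Pr : Matrix (Fin N) (Fin N) ℝ} (hPr : ∀ i j, 0 ≤ Pr i j)
    {V : Fin N → Matrix (Fin d) (Fin d) ℝ} (hV : ∀ i, (V i).PosSemidef) (i : Fin N) :
    (opE Pr V i).PosSemidef :=
  Matrix.posSemidef_sum _ fun j _ => (hV j).smul (hPr i j)

lemma psd_conj {a b : ℕ} {M : Matrix (Fin a) (Fin a) ℝ} (hM : M.PosSemidef)
    (G : Matrix (Fin a) (Fin b) ℝ) : (Gᵀ * M * G).PosSemidef := by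
  simpa using hM.conjTranspose_mul_mul_same G

lemma opL_psd {d N : ℕ} {Pr : Matrix (Fin N) (Fin N) ℝ} (hPr : ∀ i j, 0 ≤ Pr i j)
    (Γ : Fin N → Matrix (Fin d) (Fin d) ℝ)
    {V : Fin N → Matrix (Fin d) (Fin d) ℝ} (hV : ∀ i, (V i).PosSemidef) (i : Fin N) :
    (opL Pr Γ V i).PosSemidef :=
  psd_conj (opE_psd hPr hV i) _

lemma opT_psd {d N : ℕ} {Pr : Matrix (Fin N) (Fin N) ℝ} (hPr : ∀ i j, 0 ≤ Pr i j)
    (Γ : Fin N → Matrix (Fin d) (Fin d) ℝ)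
    {V : Fin N → Matrix (Fin d) (Fin d) ℝ} (hV : ∀ i, (V i).PosSemidef) (i : Fin N) :
    (opT Pr Γ V i).PosSemidef :=
  Matrix.posSemidef_sum _ fun j _ => by
    have := psd_conj (hV j) (Γ j)ᵀ
    rw [Matrix.transpose_transpose] at this
    exact this.smul (hPr j i)

lemma iter_psd {d N : ℕ} {F : (Fin N → Matrix (Fin d) (Fin d) ℝ) → Fin N → Matrix (Fin d) (Fin d) ℝ}
    (hF : ∀ V, (∀ i, (V i).PosSemidef) → ∀ i, (F V i).PosSemidef)
    {V : Fin N → Matrix (Fin d) (Fin d) ℝ} (hV : ∀ i, (V i).PosSemidef) (t : ℕ) :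
    ∀ i, (F^[t] V i).PosSemidef := by
  induction t with
  | zero => exact hV
  | succ n ih => rw [Function.iterate_succ_apply']; exact hF _ ih

lemma tsum_psd {d N : ℕ} {f : ℕ → Fin N → Matrix (Fin d) (Fin d) ℝ} (hs : Summable f)
    (hf : ∀ t i, (f t i).PosSemidef) (i : Fin N) : ((∑' t, f t) i).PosSemidef := by
  have h1 : HasSum (fun t => f t i) ((∑' t, f t) i) := Pi.hasSum.mp hs.hasSum i
  refine .of_dotProduct_mulVec_nonneg ?_ fun x => ?_
  · have h2 := h1.matrix_conjTranspose
    have h3 : (fun t => (f t i)ᴴ) = fun t => f t i := by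
      funext t
      exact (hf t i).1
    rw [h3] at h2
    exact h2.unique h1
  · let φ : Matrix (Fin d) (Fin d) ℝ →+ ℝ :=
      { toFun := fun M => star x ⬝ᵥ (M *ᵥ x)
        map_zero' := by simp
        map_add' := by intro a b; simp [Matrix.add_mulVec] }
    have hφ : Continuous φ := by
      change Continuous fun M : Matrix (Fin d) (Fin d) ℝ => star x ⬝ᵥ (M *ᵥ x)
      fun_prop
    exact (h1.map φ hφ).nonneg fun t => (hf t i).dotProduct_mulVec_nonneg x

lemma stab_fix_psd {d N : ℕ} {Pr : Matrix (Fin N) (Fin N) ℝ} (hPr : ∀ i j, 0 ≤ Pr i j)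
    {Γ : Fin N → Matrix (Fin d) (Fin d) ℝ} (hS : Stab Pr Γ)
    {D M : Fin N → Matrix (Fin d) (Fin d) ℝ} (hM : ∀ i, (M i).PosSemidef)
    (hD : ∀ i, D i = M i + opL Pr Γ D i) (i : Fin N) : (D i).PosSemidef := by
  have h1 := fix_tsum (linL Pr Γ) (cont_opL Pr Γ) M (hS M)
  have h2 : D - ∑' t : ℕ, (linL Pr Γ)^[t] M = 0 := by
    refine eq_zero_of_fix (linL Pr Γ) _ ?_ (hS _)
    have hD' : D = M + linL Pr Γ D := funext hD
    rw [map_sub]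
    conv_rhs => rw [h1, hD']
    abel
  rw [sub_eq_zero.mp h2]
  exact tsum_psd (hS M) (fun t => iter_psd (fun V hV => opL_psd hPr Γ hV) hM t) i

lemma dual {d N : ℕ} (Pr : Matrix (Fin N) (Fin N) ℝ) (Γ : Fin N → Matrix (Fin d) (Fin d) ℝ)
    (V X : Fin N → Matrix (Fin d) (Fin d) ℝ) :
    ∑ i, (opL Pr Γ V i * X i).trace = ∑ i, (V i * opT Pr Γ X i).trace := by
  simp only [opL, opE, opT, Finset.mul_sum, Finset.sum_mul, Matrix.trace_sum]
  rw [Finset.sum_comm]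
  refine Finset.sum_congr rfl fun j _ => Finset.sum_congr rfl fun i _ => ?_
  simp only [Matrix.mul_smul, Matrix.smul_mul, Matrix.trace_smul]
  congr 1
  rw [Matrix.mul_assoc, Matrix.mul_assoc, Matrix.trace_mul_comm]
  simp only [Matrix.mul_assoc]

lemma dual_iter {d N : ℕ} (Pr : Matrix (Fin N) (Fin N) ℝ) (Γ : Fin N → Matrix (Fin d) (Fin d) ℝ)
    (t : ℕ) (V X : Fin N → Matrix (Fin d) (Fin d) ℝ) :
    ∑ i, ((opL Pr Γ)^[t] V i * X i).trace = ∑ i, (V i * (opT Pr Γ)^[t] X i).trace := by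
  induction t generalizing V X with
  | zero => rfl
  | succ n ih =>
    rw [Function.iterate_succ_apply, Function.iterate_succ_apply', ih, dual]

lemma stab_T {d N : ℕ} {Pr : Matrix (Fin N) (Fin N) ℝ} {Γ : Fin N → Matrix (Fin d) (Fin d) ℝ}
    (hS : Stab Pr Γ) (X : Fin N → Matrix (Fin d) (Fin d) ℝ) :
    Summable fun t : ℕ => (opT Pr Γ)^[t] X := by
  refine Pi.summable.mpr fun i => Pi.summable.mpr fun a => Pi.summable.mpr fun b => ?_
  have key : ∀ Y : Fin N → Matrix (Fin d) (Fin d) ℝ,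
      ∑ j, ((Pi.single i (Matrix.single b a (1 : ℝ)) :
        Fin N → Matrix (Fin d) (Fin d) ℝ) j * Y j).trace = Y i a b := by
    intro Y
    rw [Finset.sum_eq_single i]
    · simp [Matrix.trace_single_mul]
    · intro j _ hj
      simp [Pi.single_eq_of_ne hj]
    · simp
  have h : ∀ t : ℕ, (opT Pr Γ)^[t] X i a b = ∑ j, ((opL Pr Γ)^[t]
      (Pi.single i (Matrix.single b a (1 : ℝ))) j * X j).trace := by
    intro t
    rw [dual_iter, key]
  simp only [h]
  refine summable_sum fun j _ => ?_
  have h1 := Pi.summable.mp (hS (Pi.single i (Matrix.single b a (1 : ℝ)))) j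
  let φ : Matrix (Fin d) (Fin d) ℝ →+ ℝ :=
      { toFun := fun M => (M * X j).trace
        map_zero' := by simp
        map_add' := by intro a b; simp [Matrix.add_mul] }
  have hφ : Continuous φ := by
    change Continuous fun M : Matrix (Fin d) (Fin d) ℝ => (M * X j).trace
    fun_prop
  exact h1.map φ hφ

open scoped MatrixOrder in
lemma trace_mul_psd {d : ℕ} {W X : Matrix (Fin d) (Fin d) ℝ} (hW : W.PosSemidef)
    (hX : X.PosSemidef) : 0 ≤ (W * X).trace := by
  obtain ⟨C, rfl⟩ := CStarAlgebra.nonneg_iff_eq_star_mul_self.mp hW.nonneg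
  have h := (hX.mul_mul_conjTranspose_same C).trace_nonneg
  rw [Matrix.trace_mul_comm, ← Matrix.mul_assoc] at h
  exact h

lemma sub_psd_of_eig {d : ℕ} {M : Matrix (Fin d) (Fin d) ℝ} (hM : M.IsHermitian) (c : ℝ)
    (hc : ∀ i, c ≤ hM.eigenvalues i) : (M - c • (1 : Matrix (Fin d) (Fin d) ℝ)).PosSemidef := by
  have hH : (M - c • (1 : Matrix (Fin d) (Fin d) ℝ)).IsHermitian := by
    have : (c • (1 : Matrix (Fin d) (Fin d) ℝ)).IsHermitian := by
      simp [Matrix.IsHermitian]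
    exact hM.sub this
  rw [hH.posSemidef_iff_eigenvalues_nonneg]
  intro i
  have h1 := hH.eigenvalues_mem_spectrum_real i
  have h2 : hH.eigenvalues i + c ∈ spectrum ℝ M := by
    rw [spectrum.add_mem_iff, Algebra.algebraMap_eq_smul_one, neg_add_eq_sub]
    exact h1
  rw [hM.spectrum_real_eq_range_eigenvalues] at h2
  obtain ⟨j, hj⟩ := h2
  have := hc j
  rw [hj] at this
  change 0 ≤ hH.eigenvalues i
  linarith

lemma sigmaMin_psd {d : ℕ} {M : Matrix (Fin d) (Fin d) ℝ} (hM : M.PosSemidef) :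
    (M - sigmaMin M • (1 : Matrix (Fin d) (Fin d) ℝ)).PosSemidef := by
  refine sub_psd_of_eig hM.1 _ fun i => ?_
  have hv : ‖hM.1.eigenvectorBasis i‖ = 1 := hM.1.eigenvectorBasis.norm_eq_one i
  have h1 : sigmaMin M ≤ ‖Matrix.toEuclideanLin M (hM.1.eigenvectorBasis i)‖ := by
    refine ciInf_le (f := fun x : {x : EuclideanSpace ℝ (Fin d) // ‖x‖ = 1} =>
      ‖Matrix.toEuclideanLin M x.1‖) ?_ ⟨_, hv⟩
    exact ⟨0, by rintro _ ⟨x, rfl⟩; exact norm_nonneg _⟩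
  have h2 : Matrix.toEuclideanLin M (hM.1.eigenvectorBasis i)
      = hM.1.eigenvalues i • hM.1.eigenvectorBasis i := by
    rw [Matrix.toLpLin_apply, hM.1.mulVec_eigenvectorBasis]
    rfl
  rw [h2, norm_smul, hv, mul_one, Real.norm_of_nonneg (hM.eigenvalues_nonneg i)] at h1
  exact h1

lemma sigmaMin_nonneg {d : ℕ} (M : Matrix (Fin d) (Fin d) ℝ) : 0 ≤ sigmaMin M :=
  Real.iInf_nonneg fun _ => norm_nonneg _

lemma specNorm_bdd {a b : ℕ} (M : Matrix (Fin a) (Fin b) ℝ) : BddAbove (Set.range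
    fun x : {x : EuclideanSpace ℝ (Fin b) // ‖x‖ ≤ 1} => ‖Matrix.toEuclideanLin M x.1‖) := by
  refine ⟨‖LinearMap.toContinuousLinearMap (Matrix.toEuclideanLin M)‖, ?_⟩
  rintro _ ⟨x, rfl⟩
  have := (LinearMap.toContinuousLinearMap (Matrix.toEuclideanLin M)).le_opNorm x.1
  refine this.trans ?_
  exact mul_le_of_le_one_right (norm_nonneg _) x.2

lemma specNorm_nonneg {a b : ℕ} (M : Matrix (Fin a) (Fin b) ℝ) : 0 ≤ specNorm M :=
  Real.iSup_nonneg fun _ => norm_nonneg _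

lemma le_specNorm {a b : ℕ} (M : Matrix (Fin a) (Fin b) ℝ) (x : EuclideanSpace ℝ (Fin b))
    (hx : ‖x‖ ≤ 1) : ‖Matrix.toEuclideanLin M x‖ ≤ specNorm M :=
  le_ciSup (f := fun x : {x : EuclideanSpace ℝ (Fin b) // ‖x‖ ≤ 1} =>
    ‖Matrix.toEuclideanLin M x.1‖) (specNorm_bdd M) ⟨x, hx⟩

lemma specNorm_psd {d : ℕ} {M : Matrix (Fin d) (Fin d) ℝ} (hM : M.PosSemidef) {c : ℝ}
    (hc : specNorm M ≤ c) :
    (c • (1 : Matrix (Fin d) (Fin d) ℝ) - M).PosSemidef := by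
  have key : ((-M) - (-c) • (1 : Matrix (Fin d) (Fin d) ℝ)).PosSemidef := by
    refine sub_psd_of_eig hM.1.neg _ fun i => ?_
    set v := hM.1.neg.eigenvectorBasis i
    have hv : ‖v‖ = 1 := hM.1.neg.eigenvectorBasis.norm_eq_one i
    have h1 := le_specNorm M v hv.le
    have h2 : Matrix.toEuclideanLin (-M) v = hM.1.neg.eigenvalues i • v := by
      rw [Matrix.toLpLin_apply, hM.1.neg.mulVec_eigenvectorBasis]
      rfl
    have h3 : ‖Matrix.toEuclideanLin M v‖ = ‖Matrix.toEuclideanLin (-M) v‖ := by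
      rw [map_neg, LinearMap.neg_apply, norm_neg]
    rw [h3, h2, norm_smul, hv, mul_one, Real.norm_eq_abs] at h1
    have := neg_abs_le (hM.1.neg.eigenvalues i)
    linarith
  have e : ((-M) - (-c) • (1 : Matrix (Fin d) (Fin d) ℝ)) = c • 1 - M := by
    rw [neg_smul]; abel
  rwa [e] at key

lemma le_maxNorm {a b N : ℕ} (V : Fin N → Matrix (Fin a) (Fin b) ℝ) (i : Fin N) :
    specNorm (V i) ≤ maxNorm V :=
  le_ciSup (f := fun i => specNorm (V i)) (Set.finite_range _).bddAbove i

lemma maxNorm_nonneg {a b N : ℕ} (V : Fin N → Matrix (Fin a) (Fin b) ℝ) : 0 ≤ maxNorm V :=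
  Real.iSup_nonneg fun _ => specNorm_nonneg _

lemma posDef_lower {d : ℕ} {M : Matrix (Fin d) (Fin d) ℝ} (hM : M.PosDef) :
    ∃ δ : ℝ, 0 < δ ∧ ∀ x : Fin d → ℝ, δ * (x ⬝ᵥ x) ≤ x ⬝ᵥ (M *ᵥ x) := by
  obtain ⟨δ, hδ, h⟩ : ∃ δ : ℝ, 0 < δ ∧ ∀ i, δ ≤ hM.1.eigenvalues i := by
    rcases isEmpty_or_nonempty (Fin d) with he | hne
    · exact ⟨1, one_pos, fun i => he.elim i⟩
    · obtain ⟨i, hi⟩ := Finite.exists_min hM.1.eigenvalues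
      exact ⟨_, hM.eigenvalues_pos i, hi⟩
  refine ⟨δ, hδ, fun x => ?_⟩
  have h1 := (sub_psd_of_eig hM.1 δ h).dotProduct_mulVec_nonneg x
  simp only [star_trivial, Matrix.sub_mulVec, Matrix.smul_mulVec, Matrix.one_mulVec,
    dotProduct_sub, dotProduct_smul, smul_eq_mul] at h1
  linarith

lemma form_bound {d : ℕ} (V : Matrix (Fin d) (Fin d) ℝ) (x y : Fin d → ℝ) :
    |x ⬝ᵥ (V *ᵥ y)| ≤ (∑ a, ∑ b, |V a b|) * (x ⬝ᵥ x + y ⬝ᵥ y) := by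
  simp only [dotProduct, Matrix.mulVec, Finset.mul_sum, Finset.sum_mul]
  refine (Finset.abs_sum_le_sum_abs _ _).trans (Finset.sum_le_sum fun a _ => ?_)
  refine (Finset.abs_sum_le_sum_abs _ _).trans (Finset.sum_le_sum fun b _ => ?_)
  have hx : x a * x a ≤ ∑ i, x i * x i :=
    Finset.single_le_sum (f := fun i => x i * x i) (fun i _ => mul_self_nonneg _) (Finset.mem_univ a)
  have hy : y b * y b ≤ ∑ i, y i * y i :=
    Finset.single_le_sum (f := fun i => y i * y i) (fun i _ => mul_self_nonneg _) (Finset.mem_univ b)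
  have h : |x a| * |y b| ≤ x a * x a + y b * y b := by
    rw [← abs_mul_abs_self (x a), ← abs_mul_abs_self (y b)]
    nlinarith [sq_nonneg (|x a| - |y b|), abs_nonneg (x a), abs_nonneg (y b)]
  rw [abs_mul, abs_mul]
  calc |x a| * (|V a b| * |y b|) = |V a b| * (|x a| * |y b|) := by ring
    _ ≤ |V a b| * (∑ i, x i * x i + ∑ i, y i * y i) :=
      mul_le_mul_of_nonneg_left (by linarith) (abs_nonneg _)

lemma opL_form {d N : ℕ} (Pr : Matrix (Fin N) (Fin N) ℝ) (Γ : Fin N → Matrix (Fin d) (Fin d) ℝ)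
    (V : Fin N → Matrix (Fin d) (Fin d) ℝ) (i : Fin N) (x y : Fin d → ℝ) :
    x ⬝ᵥ (opL Pr Γ V i *ᵥ y) = ∑ j, Pr i j * ((Γ i *ᵥ x) ⬝ᵥ (V j *ᵥ (Γ i *ᵥ y))) := by
  have h : ∀ u w : Fin d → ℝ, u ⬝ᵥ (opE Pr V i *ᵥ w) = ∑ j, Pr i j * (u ⬝ᵥ (V j *ᵥ w)) := by
    intro u w
    simp [opE, Matrix.sum_mulVec, dotProduct_sum, Matrix.smul_mulVec]
  rw [← h, opL, ← Matrix.mulVec_mulVec, ← Matrix.mulVec_mulVec, Matrix.dotProduct_mulVec,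
    Matrix.vecMul_transpose]

lemma stab_of_lyap {d N : ℕ} {Pr : Matrix (Fin N) (Fin N) ℝ} (hPr : ∀ i j, 0 ≤ Pr i j)
    {Γ : Fin N → Matrix (Fin d) (Fin d) ℝ} {P M : Fin N → Matrix (Fin d) (Fin d) ℝ}
    (hP : ∀ i, (P i).PosSemidef) (hM : ∀ i, (M i).PosDef)
    (hPM : ∀ i, P i = M i + opL Pr Γ P i) : Stab Pr Γ := by
  intro V
  have hMs : ∀ i, (M i).PosSemidef := fun i => (hM i).posSemidef
  have hit : ∀ t i, ((opL Pr Γ)^[t] M i).PosSemidef :=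
    fun t => iter_psd (fun V hV => opL_psd hPr Γ hV) hMs t
  have hitP : ∀ t i, ((opL Pr Γ)^[t] P i).PosSemidef :=
    fun t => iter_psd (fun V hV => opL_psd hPr Γ hV) hP t
  -- telescoping
  have htel : ∀ n, P = ∑ t ∈ Finset.range n, (linL Pr Γ)^[t] M + (linL Pr Γ)^[n] P := by
    intro n
    induction n with
    | zero => simp
    | succ n ih =>
      have hP' : P = M + linL Pr Γ P := funext hPM
      conv_lhs => rw [ih]
      rw [Finset.sum_range_succ, Function.iterate_succ_apply, add_assoc]
      congr 1
      conv_lhs => rw [hP']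
      rw [← Module.End.coe_pow, map_add]
  have hsq : ∀ i (x : Fin d → ℝ), Summable fun t : ℕ => x ⬝ᵥ ((opL Pr Γ)^[t] M i *ᵥ x) := by
    intro i x
    refine summable_of_sum_range_le (c := x ⬝ᵥ (P i *ᵥ x)) (fun t => ?_) fun n => ?_
    · exact (hit t i).dotProduct_mulVec_nonneg x
    · have h1 := congrArg (fun W => x ⬝ᵥ (W i *ᵥ x)) (htel n)
      simp only [Pi.add_apply, Finset.sum_apply, Matrix.add_mulVec, Matrix.sum_mulVec,
        dotProduct_add, dotProduct_sum] at h1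
      have h2 : 0 ≤ x ⬝ᵥ ((opL Pr Γ)^[n] P i *ᵥ x) := (hitP n i).dotProduct_mulVec_nonneg x
      rw [h1]
      exact le_add_of_nonneg_right h2
  obtain ⟨m, hm⟩ : ∃ m : ℝ, ∀ i (x y : Fin d → ℝ), |x ⬝ᵥ (V i *ᵥ y)|
      ≤ m * (x ⬝ᵥ (M i *ᵥ x) + y ⬝ᵥ (M i *ᵥ y)) := by
    choose δ hδ hlow using fun i => posDef_lower (hM i)
    have hnn : ∀ i, 0 ≤ (∑ a, ∑ b, |V i a b|) / δ i := fun i =>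
      div_nonneg (Finset.sum_nonneg fun a _ => Finset.sum_nonneg fun b _ => abs_nonneg _) (hδ i).le
    refine ⟨∑ i, (∑ a, ∑ b, |V i a b|) / δ i, fun i x y => ?_⟩
    have hq : ∀ x : Fin d → ℝ, 0 ≤ x ⬝ᵥ (M i *ᵥ x) := fun x => (hMs i).dotProduct_mulVec_nonneg x
    calc |x ⬝ᵥ (V i *ᵥ y)| ≤ (∑ a, ∑ b, |V i a b|) * (x ⬝ᵥ x + y ⬝ᵥ y) := form_bound _ _ _
      _ = (∑ a, ∑ b, |V i a b|) / δ i * (δ i * (x ⬝ᵥ x) + δ i * (y ⬝ᵥ y)) := by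
        have := (hδ i).ne'
        field_simp
      _ ≤ (∑ a, ∑ b, |V i a b|) / δ i * (x ⬝ᵥ (M i *ᵥ x) + y ⬝ᵥ (M i *ᵥ y)) :=
        mul_le_mul_of_nonneg_left (add_le_add (hlow i x) (hlow i y)) (hnn i)
      _ ≤ _ := mul_le_mul_of_nonneg_right
        (Finset.single_le_sum (f := fun i => (∑ a, ∑ b, |V i a b|) / δ i)
          (fun i _ => hnn i) (Finset.mem_univ i)) (add_nonneg (hq x) (hq y))
  have hmt : ∀ t : ℕ, ∀ i (x y : Fin d → ℝ), |x ⬝ᵥ ((opL Pr Γ)^[t] V i *ᵥ y)|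
      ≤ m * (x ⬝ᵥ ((opL Pr Γ)^[t] M i *ᵥ x) + y ⬝ᵥ ((opL Pr Γ)^[t] M i *ᵥ y)) := by
    intro t
    induction t with
    | zero => exact hm
    | succ n ih =>
      intro i x y
      simp only [Function.iterate_succ_apply', opL_form]
      rw [← Finset.sum_add_distrib, Finset.mul_sum]
      refine (Finset.abs_sum_le_sum_abs _ _).trans (Finset.sum_le_sum fun j _ => ?_)
      rw [abs_mul, abs_of_nonneg (hPr i j)]
      calc _ ≤ Pr i j * _ := mul_le_mul_of_nonneg_left (ih j (Γ i *ᵥ x) (Γ i *ᵥ y)) (hPr i j)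
        _ = _ := by ring
  refine Pi.summable.mpr fun i => Pi.summable.mpr fun a => Pi.summable.mpr fun b => ?_
  have hb : ∀ t : ℕ, (opL Pr Γ)^[t] V i a b
      = (Pi.single a 1 : Fin d → ℝ) ⬝ᵥ ((opL Pr Γ)^[t] V i *ᵥ Pi.single b 1) := by
    intro t
    simp
  refine Summable.of_norm_bounded (g := fun t => m *
    ((Pi.single a 1 : Fin d → ℝ) ⬝ᵥ ((opL Pr Γ)^[t] M i *ᵥ Pi.single a 1)
      + (Pi.single b 1 : Fin d → ℝ) ⬝ᵥ ((opL Pr Γ)^[t] M i *ᵥ Pi.single b 1)))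
    (((hsq i _).add (hsq i _)).mul_left m) fun t => ?_
  rw [hb, Real.norm_eq_abs]
  exact hmt t i _ _

section
attribute [local instance] Matrix.linftyOpNormedRing Matrix.linftyOpNormedAlgebra

lemma summable_pow_entries {n : Type*} [Fintype n] [DecidableEq n] (a : Matrix n n ℂ)
    (h : spectralRadius ℂ a < 1) (i j : n) : Summable fun t : ℕ => ‖(a ^ t) i j‖ := by
  have hg := spectrum.pow_nnnorm_pow_one_div_tendsto_nhds_spectralRadius a
  obtain ⟨r, hr1, hr2⟩ := ENNReal.lt_iff_exists_nnreal_btwn.mp h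
  have hev := hg.eventually_lt_const hr1
  have hr : (r : ℝ) < 1 := by exact_mod_cast hr2
  refine Summable.of_norm_bounded_eventually_nat (g := fun t => (r : ℝ) ^ t)
    (summable_geometric_of_lt_one r.2 hr) ?_
  filter_upwards [hev, eventually_gt_atTop 0] with t ht ht0
  rw [norm_norm]
  have h1 : ‖(a ^ t) i j‖₊ ≤ ‖a ^ t‖₊ := by
    rw [Matrix.linfty_opNNNorm_def]
    exact (Finset.single_le_sum (f := fun j => ‖(a ^ t) i j‖₊) (fun _ _ => zero_le)
      (Finset.mem_univ j)).trans
      (Finset.le_sup (f := fun i => ∑ j, ‖(a ^ t) i j‖₊) (Finset.mem_univ i))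
  have h2 : ‖a ^ t‖₊ ≤ r ^ t := by
    have ht' : (0 : ℝ) < t := by exact_mod_cast ht0
    have h3 := ENNReal.rpow_le_rpow ht.le ht'.le
    rw [← ENNReal.rpow_mul, one_div, inv_mul_cancel₀ ht'.ne', ENNReal.rpow_one,
      ENNReal.rpow_natCast] at h3
    exact_mod_cast h3
  exact_mod_cast h1.trans h2

end

lemma calA_mulVec {d N : ℕ} (Pr : Matrix (Fin N) (Fin N) ℝ)
    (Γ : Fin N → Matrix (Fin d) (Fin d) ℝ) (V : Fin N → Matrix (Fin d) (Fin d) ℝ) :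
    calA Pr Γ *ᵥ (fun q => V q.1 q.2.1 q.2.2) = fun q => opL Pr Γ V q.1 q.2.1 q.2.2 := by
  have h1 : (Pr ⊗ₖ (1 : Matrix (Fin d × Fin d) (Fin d × Fin d) ℝ)) *ᵥ
      (fun q => V q.1 q.2.1 q.2.2) = fun q => opE Pr V q.1 q.2.1 q.2.2 := by
    funext ⟨i, a, b⟩
    simp only [Matrix.mulVec, dotProduct, Fintype.sum_prod_type, Matrix.kroneckerMap_apply, opE,
      Matrix.sum_apply, Matrix.smul_apply, smul_eq_mul]
    refine Finset.sum_congr rfl fun j _ => ?_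
    simp only [← Fintype.sum_prod_type']
    rw [Finset.sum_eq_single (a, b)]
    · simp
    · intro q _ hq
      have : (1 : Matrix (Fin d × Fin d) (Fin d × Fin d) ℝ) (a, b) q = 0 :=
        Matrix.one_apply_ne hq.symm
      simp [this]
    · simp
  rw [calA, ← Matrix.mulVec_mulVec, h1]
  funext ⟨i, a, b⟩
  simp only [Matrix.mulVec, dotProduct, Fintype.sum_prod_type, Matrix.reindex_apply,
    Matrix.submatrix_apply, Matrix.blockDiagonal_apply, opL, Matrix.mul_apply]
  rw [Finset.sum_eq_single i]
  · simp [Matrix.kroneckerMap_apply, Finset.sum_mul]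
    rw [Finset.sum_comm]
    refine Finset.sum_congr rfl fun j _ => Finset.sum_congr rfl fun k _ => ?_
    ring
  · intro j _ hj
    simp [hj.symm]
  · simp

lemma stab_of_MSS {d k N : ℕ} {Pr : Matrix (Fin N) (Fin N) ℝ}
    {A : Fin N → Matrix (Fin d) (Fin d) ℝ} {B : Fin N → Matrix (Fin d) (Fin k) ℝ}
    {K : Fin N → Matrix (Fin k) (Fin d) ℝ} (hK : MSS Pr A B K) : Stab Pr (Gam A B K) := by
  intro V
  refine Pi.summable.mpr fun i => Pi.summable.mpr fun a => Pi.summable.mpr fun b => ?_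
  set C := calA Pr (Gam A B K) with hC
  have hpow : ∀ t : ℕ, (C ^ t) *ᵥ (fun q => V q.1 q.2.1 q.2.2)
      = fun q => (opL Pr (Gam A B K))^[t] V q.1 q.2.1 q.2.2 := by
    intro t
    induction t with
    | zero => simp
    | succ n ih =>
      rw [pow_succ', ← Matrix.mulVec_mulVec, ih, calA_mulVec, Function.iterate_succ_apply']
  have h1 : ∀ t : ℕ, (opL Pr (Gam A B K))^[t] V i a b
      = ∑ q, (C ^ t) (i, a, b) q * V q.1 q.2.1 q.2.2 := by
    intro t
    have := congrFun (hpow t) (i, a, b)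
    exact this.symm
  simp only [h1]
  refine summable_sum fun q _ => Summable.mul_right _ ?_
  refine Summable.of_norm ?_
  have h2 := summable_pow_entries _ hK (i, a, b) q
  refine h2.congr fun t => ?_
  have h3 : (C.map (algebraMap ℝ ℂ)) ^ t = (C ^ t).map (algebraMap ℝ ℂ) := by
    rw [Matrix.map_pow]
  rw [h3]
  simp

lemma quad_identity {d k : ℕ} (Q E A : Matrix (Fin d) (Fin d) ℝ) (R : Matrix (Fin k) (Fin k) ℝ)
    (B : Matrix (Fin d) (Fin k) ℝ) (K D : Matrix (Fin k) (Fin d) ℝ) (hE : Eᵀ = E) (hR : Rᵀ = R) :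
    Q + (K + D)ᵀ * R * (K + D) + (A - B * (K + D))ᵀ * E * (A - B * (K + D))
      = Q + Kᵀ * R * K + (A - B * K)ᵀ * E * (A - B * K)
        + (Dᵀ * ((R + Bᵀ * E * B) * K - Bᵀ * E * A) + ((R + Bᵀ * E * B) * K - Bᵀ * E * A)ᵀ * D
          + Dᵀ * (R + Bᵀ * E * B) * D) := by
  simp only [Matrix.transpose_add, Matrix.transpose_sub, Matrix.transpose_mul,
    Matrix.transpose_transpose, hE, hR, Matrix.mul_add, Matrix.add_mul, Matrix.mul_sub,
    Matrix.sub_mul, Matrix.mul_assoc]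
  abel

lemma PK_spec {d k N : ℕ} {Pr : Matrix (Fin N) (Fin N) ℝ}
    {A : Fin N → Matrix (Fin d) (Fin d) ℝ} {B : Fin N → Matrix (Fin d) (Fin k) ℝ}
    (Q : Fin N → Matrix (Fin d) (Fin d) ℝ) (R : Fin N → Matrix (Fin k) (Fin k) ℝ)
    {K : Fin N → Matrix (Fin k) (Fin d) ℝ} (hS : Stab Pr (Gam A B K)) :
    IsLyap Pr A B Q R K (PK Pr A B Q R K) := by
  have hex : ∃ P, IsLyap Pr A B Q R K P := by
    let M : Fin N → Matrix (Fin d) (Fin d) ℝ := fun i => Q i + (K i)ᵀ * R i * K i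
    refine ⟨∑' t : ℕ, (linL Pr (Gam A B K))^[t] M, fun i => ?_⟩
    exact congrFun (fix_tsum (linL Pr (Gam A B K)) (cont_opL _ _) M (hS M)) i
  rw [PK, dif_pos hex]
  exact hex.choose_spec

lemma cost_diff {d k N : ℕ} {Pr : Matrix (Fin N) (Fin N) ℝ} (hPr : ∀ i j, 0 ≤ Pr i j)
    {A : Fin N → Matrix (Fin d) (Fin d) ℝ} {B : Fin N → Matrix (Fin d) (Fin k) ℝ}
    {Q : Fin N → Matrix (Fin d) (Fin d) ℝ} {R : Fin N → Matrix (Fin k) (Fin k) ℝ}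
    (hR : ∀ i, (R i).PosDef)
    {K K2 : Fin N → Matrix (Fin k) (Fin d) ℝ}
    {P P2 : Fin N → Matrix (Fin d) (Fin d) ℝ} (hPs : ∀ i, (P i).PosSemidef)
    (hP : IsLyap Pr A B Q R K P) (hP2 : IsLyap Pr A B Q R K2 P2)
    (D L : Fin N → Matrix (Fin k) (Fin d) ℝ) (G : Fin N → Matrix (Fin k) (Fin k) ℝ)
    (hG : ∀ i, G i = R i + (B i)ᵀ * opE Pr P i * B i)
    (hL : ∀ i, L i = G i * K i - (B i)ᵀ * opE Pr P i * A i)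
    (hD : ∀ i, K2 i = K i + D i) (i : Fin N) :
    (P - P2) i = -((D i)ᵀ * L i + (L i)ᵀ * D i + (D i)ᵀ * G i * D i)
      + opL Pr (Gam A B K2) (P - P2) i := by
  have hE : (opE Pr P i)ᵀ = opE Pr P i := by
    simpa using (opE_psd hPr hPs i).1.eq
  have hRt : (R i)ᵀ = R i := by simpa using (hR i).1.eq
  have h1 := quad_identity (Q i) (opE Pr P i) (A i) (R i) (B i) (K i) (D i) hE hRt
  rw [← hG, ← hL, ← hD] at h1
  have h2 := hP i
  have h3 := hP2 i
  simp only [Gam] at h2 h3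
  rw [← h2] at h1
  have h4 : opL Pr (Gam A B K2) (P - P2) i
      = (A i - B i * K2 i)ᵀ * opE Pr P i * (A i - B i * K2 i)
        - (A i - B i * K2 i)ᵀ * opE Pr P2 i * (A i - B i * K2 i) := by
    change linL Pr (Gam A B K2) (P - P2) i = _
    rw [map_sub]
    rfl
  rw [h4, Pi.sub_apply]
  rw [eq_sub_of_add_eq h1.symm, h3]
  abel

/-- one-step contraction of the Gauss-Newton method, main estimates. -/
lemma main_aux {d k N : ℕ}
    (A : Fin N → Matrix (Fin d) (Fin d) ℝ) (B : Fin N → Matrix (Fin d) (Fin k) ℝ)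
    (Pr : Matrix (Fin N) (Fin N) ℝ)
    (hPr : ∀ i j, 0 ≤ Pr i j)
    (piv : Fin N → ℝ) (hpiv : ∀ i, 0 < piv i)
    (Sg : Matrix (Fin d) (Fin d) ℝ) (hSg : Sg.PosDef)
    (Q : Fin N → Matrix (Fin d) (Fin d) ℝ) (hQ : ∀ i, (Q i).PosDef)
    (R : Fin N → Matrix (Fin k) (Fin k) ℝ) (hR : ∀ i, (R i).PosDef)
    (K : Fin N → Matrix (Fin k) (Fin d) ℝ) (hK : MSS Pr A B K)
    (η : ℝ) (hη0 : 0 < η) (hη : η ≤ 1 / 2)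
    (Ks : Fin N → Matrix (Fin k) (Fin d) ℝ) (hKs : MSS Pr A B Ks) :
    ∃ w : ℝ, 0 ≤ w ∧
      cost Pr A B Q R piv Sg K - cost Pr A B Q R piv Sg Ks
        ≤ maxNorm (XK Pr piv Sg (Gam A B Ks)) * w ∧
      2 * mu piv Sg * η * w ≤ cost Pr A B Q R piv Sg K - cost Pr A B Q R piv Sg (fun i => K i - (2 * η) • ((R i + (B i)ᵀ * opE Pr (PK Pr A B Q R K) i * B i)⁻¹ * LK Pr A B Q R K i)) := by
  have hSK := stab_of_MSS hK
  have hSs := stab_of_MSS hKs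
  have hP := PK_spec Q R hSK
  have hPss := PK_spec Q R hSs
  set P := PK Pr A B Q R K with hPdef
  have hQK : ∀ K2 : Fin N → Matrix (Fin k) (Fin d) ℝ, ∀ i,
      (Q i + (K2 i)ᵀ * R i * K2 i).PosDef := fun K2 i =>
    (hQ i).add_posSemidef (psd_conj (hR i).posSemidef _)
  have hPs : ∀ i, (P i).PosSemidef :=
    stab_fix_psd hPr hSK (fun i => (hQK K i).posSemidef) hP
  obtain ⟨G, hG⟩ : ∃ G : Fin N → Matrix (Fin k) (Fin k) ℝ,
      ∀ i, G i = R i + (B i)ᵀ * opE Pr P i * B i := ⟨_, fun _ => rfl⟩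
  obtain ⟨L, hLdef⟩ : ∃ L, L = LK Pr A B Q R K := ⟨_, rfl⟩
  have hL : ∀ i, L i = G i * K i - (B i)ᵀ * opE Pr P i * A i := by
    intro i
    rw [hLdef, hG]
    rfl
  simp only [← hG, ← hLdef]
  have hGpd : ∀ i, (G i).PosDef := fun i => by
    rw [hG]
    exact (hR i).add_posSemidef (psd_conj (opE_psd hPr hPs i) _)
  have hGt : ∀ i, (G i)ᵀ = G i := fun i => by simpa using (hGpd i).1.eq
  have hGit : ∀ i, ((G i)⁻¹)ᵀ = (G i)⁻¹ := fun i => by simpa using (hGpd i).inv.1.eq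
  have hdet : ∀ i, IsUnit (G i).det := fun i => (Matrix.isUnit_iff_isUnit_det _).mp (hGpd i).isUnit
  obtain ⟨W, hW⟩ : ∃ W : Fin N → Matrix (Fin d) (Fin d) ℝ,
      ∀ i, W i = (L i)ᵀ * (G i)⁻¹ * L i := ⟨_, fun _ => rfl⟩
  have hWp : ∀ i, (W i).PosSemidef := fun i => by
    rw [hW]
    exact psd_conj (hGpd i).inv.posSemidef _
  refine ⟨∑ i, (W i).trace, Finset.sum_nonneg fun i _ => (hWp i).trace_nonneg, ?_, ?_⟩
  · -- gradient domination
    have hcd := cost_diff hPr hR hPs hP hPss (fun i => Ks i - K i) L G hG hL (fun i => by abel)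
    set Ps := PK Pr A B Q R Ks with hPsdef
    set Γ := Gam A B Ks with hΓ
    let X0 : Fin N → Matrix (Fin d) (Fin d) ℝ := fun i => piv i • Sg
    have hX0 : ∀ i, (X0 i).PosSemidef := fun i => hSg.posSemidef.smul (hpiv i).le
    have hXs := stab_T hSs X0
    have hX : XK Pr piv Sg Γ = X0 + opT Pr Γ (XK Pr piv Sg Γ) :=
      fix_tsum (linT Pr Γ) (cont_opT Pr Γ) X0 hXs
    have hXp : ∀ i, (XK Pr piv Sg Γ i).PosSemidef :=
      tsum_psd hXs (fun t => iter_psd (fun V hV => opT_psd hPr Γ hV) hX0 t)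
    set X := XK Pr piv Sg Γ with hXdef
    have e1 : cost Pr A B Q R piv Sg K - cost Pr A B Q R piv Sg Ks
        = ∑ i, ((P - Ps) i * X0 i).trace := by
      rw [cost, cost, ← Finset.sum_sub_distrib]
      refine Finset.sum_congr rfl fun i _ => ?_
      simp [X0, Matrix.sub_mul, mul_sub, ← hPdef, ← hPsdef]
    have e2 : ∑ i, ((P - Ps) i * X0 i).trace
        = ∑ i, (((P - Ps) i - opL Pr Γ (P - Ps) i) * X i).trace := by
      have h := dual Pr Γ (P - Ps) X
      have hX' : ∀ i, X0 i = X i - opT Pr Γ X i := fun i => by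
        have := congrFun hX i
        rw [Pi.add_apply] at this
        exact eq_sub_of_add_eq this.symm
      simp only [hX', Matrix.mul_sub, Matrix.sub_mul, Matrix.trace_sub, Finset.sum_sub_distrib, h]
    rw [e1, e2, Finset.mul_sum]
    refine Finset.sum_le_sum fun i _ => ?_
    have hF : W i - ((P - Ps) i - opL Pr Γ (P - Ps) i)
        = (Ks i - K i + (G i)⁻¹ * L i)ᵀ * G i * (Ks i - K i + (G i)⁻¹ * L i) := by
      rw [sub_eq_of_eq_add (hcd i)]
      generalize Ks i - K i = D
      rw [hW]
      simp only [Matrix.transpose_add, Matrix.transpose_mul, hGit, Matrix.add_mul, Matrix.mul_add,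
        Matrix.mul_assoc, Matrix.mul_nonsing_inv_cancel_left _ _ (hdet i),
        Matrix.nonsing_inv_mul_cancel_left _ _ (hdet i)]
      abel
    have hFp : (W i - ((P - Ps) i - opL Pr Γ (P - Ps) i)).PosSemidef := by
      rw [hF]
      exact psd_conj (hGpd i).posSemidef _
    have t1 := trace_mul_psd hFp (hXp i)
    have t2 := trace_mul_psd (hWp i) (specNorm_psd (hXp i) (le_maxNorm X i))
    rw [Matrix.sub_mul, Matrix.trace_sub] at t1
    rw [Matrix.mul_sub, Matrix.trace_sub, Matrix.mul_smul, Matrix.mul_one, Matrix.trace_smul,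
      smul_eq_mul] at t2
    linarith
  · -- sufficient decrease
    obtain ⟨K2, hK2⟩ : ∃ K2 : Fin N → Matrix (Fin k) (Fin d) ℝ,
      K2 = fun i => K i - (2 * η) • ((G i)⁻¹ * L i) := ⟨_, rfl⟩
    rw [← hK2]
    obtain ⟨D, hD⟩ : ∃ D : Fin N → Matrix (Fin k) (Fin d) ℝ,
      ∀ i, D i = -((2 * η) • ((G i)⁻¹ * L i)) := ⟨_, fun _ => rfl⟩
    have hKD : ∀ i, K2 i = K i + D i := fun i => by rw [hK2, hD, ← sub_eq_add_neg]
    have hSD : ∀ i, -((D i)ᵀ * L i + (L i)ᵀ * D i + (D i)ᵀ * G i * D i)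
        = (4 * η * (1 - η)) • W i := by
      intro i
      rw [hD, hW]
      simp only [Matrix.transpose_neg, Matrix.transpose_smul, Matrix.transpose_mul, hGit,
        Matrix.neg_mul, Matrix.mul_neg, Matrix.smul_mul, Matrix.mul_smul,
        Matrix.mul_assoc, Matrix.mul_nonsing_inv_cancel_left _ _ (hdet i),
        Matrix.nonsing_inv_mul_cancel_left _ _ (hdet i)]
      module
    have hc : 0 ≤ 4 * η * (1 - η) := by nlinarith
    have hcW : ∀ i, ((4 * η * (1 - η)) • W i).PosSemidef := fun i => (hWp i).smul hc
    have hS2 : Stab Pr (Gam A B K2) := by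
      refine stab_of_lyap hPr hPs
        (M := fun i => (Q i + (K2 i)ᵀ * R i * K2 i) + (4 * η * (1 - η)) • W i)
        (fun i => (hQK K2 i).add_posSemidef (hcW i)) fun i => ?_
      have hE : (opE Pr P i)ᵀ = opE Pr P i := by simpa using (opE_psd hPr hPs i).1.eq
      have hRt : (R i)ᵀ = R i := by simpa using (hR i).1.eq
      have h1 := quad_identity (Q i) (opE Pr P i) (A i) (R i) (B i) (K i) (D i) hE hRt
      have h2 := hP i
      simp only [Gam] at h2
      rw [← hG, ← hL, ← hKD, ← h2] at h1
      have h3 : P i = Q i + (K2 i)ᵀ * R i * K2 i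
        + (A i - B i * K2 i)ᵀ * opE Pr P i * (A i - B i * K2 i)
        + -((D i)ᵀ * L i + (L i)ᵀ * D i + (D i)ᵀ * G i * D i) := by
        rw [h1]; abel
      rw [hSD] at h3
      rw [add_right_comm]
      exact h3
    have hP2 := PK_spec Q R hS2
    have hcd := cost_diff hPr hR hPs hP hP2 D L G hG hL hKD
    set P2 := PK Pr A B Q R K2 with hP2def
    simp only [hSD] at hcd
    have hDp := stab_fix_psd hPr hS2 hcW hcd
    have e1 : cost Pr A B Q R piv Sg K - cost Pr A B Q R piv Sg K2
        = ∑ i, piv i * ((P - P2) i * Sg).trace := by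
      rw [cost, cost, ← Finset.sum_sub_distrib]
      refine Finset.sum_congr rfl fun i _ => ?_
      simp [Matrix.sub_mul, mul_sub, ← hPdef, ← hP2def]
    rw [e1, Finset.mul_sum]
    refine Finset.sum_le_sum fun i _ => ?_
    have t1 := trace_mul_psd (opL_psd hPr (Gam A B K2) hDp i) hSg.posSemidef
    have t2 := trace_mul_psd (hWp i) (sigmaMin_psd hSg.posSemidef)
    have t3 : ((P - P2) i * Sg).trace = (4 * η * (1 - η)) * (W i * Sg).trace
        + (opL Pr (Gam A B K2) (P - P2) i * Sg).trace := by
      conv_lhs => rw [hcd i]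
      rw [Matrix.add_mul, Matrix.trace_add, Matrix.smul_mul, Matrix.trace_smul, smul_eq_mul]
    rw [Matrix.mul_sub, Matrix.trace_sub, Matrix.mul_smul, Matrix.mul_one, Matrix.trace_smul,
      smul_eq_mul] at t2
    have t4 : (⨅ i, piv i) ≤ piv i := ciInf_le (Set.finite_range _).bddBelow i
    have t5 : 0 ≤ ⨅ i, piv i := Real.iInf_nonneg fun i => (hpiv i).le
    have t6 := sigmaMin_nonneg Sg
    have t7 := (hWp i).trace_nonneg
    have t8 : sigmaMin Sg * (W i).trace ≤ (W i * Sg).trace := by linarith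
    have t9 : 0 ≤ sigmaMin Sg * (W i).trace := mul_nonneg t6 t7
    have t10 : (2 * η) * (sigmaMin Sg * (W i).trace) ≤ ((P - P2) i * Sg).trace := by
      have a1 : (2 * η) * (sigmaMin Sg * (W i).trace)
          ≤ (4 * η * (1 - η)) * (sigmaMin Sg * (W i).trace) :=
        mul_le_mul_of_nonneg_right (by nlinarith) t9
      have a2 := mul_le_mul_of_nonneg_left t8 hc
      linarith
    calc 2 * mu piv Sg * η * (W i).trace
        = (⨅ i, piv i) * ((2 * η) * (sigmaMin Sg * (W i).trace)) := by rw [mu]; ring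
      _ ≤ piv i * ((P - P2) i * Sg).trace :=
        mul_le_mul t4 t10 (by positivity) (hpiv i).le

/-- one-step contraction of the Gauss-Newton method. -/
theorem gauss_newton_one_step_contraction
    (d k N : ℕ) (hd : 0 < d) (hk : 0 < k) (hN : 0 < N)
    (A : Fin N → Matrix (Fin d) (Fin d) ℝ) (B : Fin N → Matrix (Fin d) (Fin k) ℝ)
    (Pr : Matrix (Fin N) (Fin N) ℝ)
    (hPr : ∀ i j, 0 ≤ Pr i j) (hPrSum : ∀ i, ∑ j, Pr i j = 1)
    (piv : Fin N → ℝ) (hpiv : ∀ i, 0 < piv i) (hpivSum : ∑ i, piv i = 1)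
    (Sg : Matrix (Fin d) (Fin d) ℝ) (hSg : Sg.PosDef)
    (Q : Fin N → Matrix (Fin d) (Fin d) ℝ) (hQ : ∀ i, (Q i).PosDef)
    (R : Fin N → Matrix (Fin k) (Fin k) ℝ) (hR : ∀ i, (R i).PosDef)
    (K : Fin N → Matrix (Fin k) (Fin d) ℝ) (hK : MSS Pr A B K)
    (η : ℝ) (hη0 : 0 < η) (hη : η ≤ 1 / 2)
    (Ks : Fin N → Matrix (Fin k) (Fin d) ℝ) (hKs : MSS Pr A B Ks)
    (hopt : ∀ K' : Fin N → Matrix (Fin k) (Fin d) ℝ, MSS Pr A B K' → cost Pr A B Q R piv Sg Ks ≤ cost Pr A B Q R piv Sg K') :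
    cost Pr A B Q R piv Sg (fun i => K i - (2 * η) • ((R i + (B i)ᵀ * opE Pr (PK Pr A B Q R K) i * B i)⁻¹ * LK Pr A B Q R K i)) - cost Pr A B Q R piv Sg Ks
      ≤ (1 - 2 * mu piv Sg * η / maxNorm (XK Pr piv Sg (Gam A B Ks)))
          * (cost Pr A B Q R piv Sg K - cost Pr A B Q R piv Sg Ks) := by
  obtain ⟨w, hw, h1, h2⟩ := main_aux A B Pr hPr piv hpiv Sg hSg Q hQ R hR K hK η hη0 hη Ks hKs
  have hX := maxNorm_nonneg (XK Pr piv Sg (Gam A B Ks))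
  have hmu : 0 ≤ mu piv Sg :=
    mul_nonneg (Real.iInf_nonneg fun i => (hpiv i).le) (sigmaMin_nonneg Sg)
  generalize maxNorm (XK Pr piv Sg (Gam A B Ks)) = x at *
  generalize cost Pr A B Q R piv Sg K = cK at *
  generalize cost Pr A B Q R piv Sg Ks = cs at *
  have h3 : 2 * mu piv Sg * η / x * (cK - cs) ≤ 2 * mu piv Sg * η * w := by
    rcases hX.eq_or_lt with h0 | h0
    · rw [← h0, div_zero, zero_mul]
      positivity
    · calc 2 * mu piv Sg * η / x * (cK - cs) ≤ 2 * mu piv Sg * η / x * (x * w) :=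
            mul_le_mul_of_nonneg_left h1 (by positivity)
        _ = 2 * mu piv Sg * η * w := by field_simp
  linarith

end MJLS
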